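/- Any finite-state ergodic Markov decision process is a value-stable environment. -/

import Mathlib

open MeasureTheory Filter Finset Asymptotics
open scoped ENNReal Classical

noncomputable section

namespace RL

/-- A perception `x = (r, o)`: a reward `r ∈ R = {0, …, r_max}` together with an
observation `o ∈ O`. -/
abbrev Percept (O : Type) (rmax : ℕ) := Fin (rmax + 1) × O

/-- A cycle `z = (y, r, o)`: an action together with the resulting perception. -/
abbrev Cycle (Y O : Type) (rmax : ℕ) := Y × Percept O rmax

/-- A deterministic policy maps a history `z_{<k}` to the next action `y_k`. -/
abbrev Policy (Y O : Type) (rmax : ℕ) := List (Cycle Y O rmax) → Y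

/-- An infinite interaction sequence. -/
abbrev Traj (Y O : Type) (rmax : ℕ) := ℕ → Cycle Y O rmax

instance (Y O : Type) (rmax : ℕ) : MeasurableSpace (Cycle Y O rmax) := ⊤

/-- The reward of a cycle `z = (y, (r, o))`, as a real number. -/
def rew {Y O : Type} {rmax : ℕ} (z : Cycle Y O rmax) : ℝ := ((z.2.1 : ℕ) : ℝ)

/-- The cylinder set of all infinite sequences extending the finite sequence `l`. -/
def cylSet {A : Type} (l : List A) : Set (ℕ → A) := {ω | ∀ i : Fin l.length, ω i.1 = l.get i}

/-- An environment: conditional probabilities `ν(x_k | z_{<k} y_k)` of the next perception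
given the history, together with, for each (deterministic) policy `p`, the induced
probability measure on interaction sequences, which on cylinder sets is given by the
product of the conditional probabilities (actions being forced by the policy). -/
structure Environment (Y O : Type) [Fintype Y] [Fintype O] (rmax : ℕ) where
  cond : List (Cycle Y O rmax) → Y → Percept O rmax → ℝ
  cond_nonneg : ∀ h y x, 0 ≤ cond h y x
  cond_sum_one : ∀ h y, ∑ x : Percept O rmax, cond h y x = 1
  P : Policy Y O rmax → Measure (Traj Y O rmax)
  P_prob : ∀ p, IsProbabilityMeasure (P p)
  P_cyl : ∀ (p : Policy Y O rmax) (h : List (Cycle Y O rmax)) (z : Cycle Y O rmax),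
    P p (cylSet (h ++ [z]))
      = P p (cylSet h) * ENNReal.ofReal (if z.1 = p h then cond h z.1 z.2 else 0)

variable {Y O : Type} [Fintype Y] [Fintype O] {rmax : ℕ}

/-- The average reward `(1/m) r_{1..m}` of the first `m` steps of a trajectory. -/
def avg {Y O : Type} {rmax : ℕ} (ω : Traj Y O rmax) (m : ℕ) : ℝ :=
  (∑ i ∈ Finset.range m, rew (ω i)) / m

/-- `V(ν,p) = V` : the average limiting value exists a.s. and equals the constant `V`. -/
def ValueIs (ν : Environment Y O rmax) (p : Policy Y O rmax) (V : ℝ) : Prop :=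
  ν.P p {ω | Tendsto (avg ω) atTop (nhds V)} = 1

/-- `V̄(ν,p) = V` : the upper limiting average value is a.s. the constant `V`. -/
def UpperValueIs (ν : Environment Y O rmax) (p : Policy Y O rmax) (V : ℝ) : Prop :=
  ν.P p {ω | limsup (avg ω) atTop = V} = 1

/-- `V` is the optimal value `V*_ν` of `ν`: some policy `p_ν` achieves average value `V`
a.s., and every policy has upper average value `≤ V` a.s. -/
def IsOptimalValue (ν : Environment Y O rmax) (V : ℝ) : Prop :=
  ∃ p, ValueIs ν p V ∧ ∀ q : Policy Y O rmax, ν.P q {ω | limsup (avg ω) atTop ≤ V} = 1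

/-- An environment is explorable if it has an optimal value `V*_ν`. -/
def Explorable (ν : Environment Y O rmax) : Prop := ∃ V, IsOptimalValue ν V

/-- `V` is the upper optimal value `V̄*_ν` of `ν`. -/
def IsUpperOptimalValue (ν : Environment Y O rmax) (V : ℝ) : Prop :=
  ∃ p, UpperValueIs ν p V ∧ ∀ q : Policy Y O rmax, ν.P q {ω | limsup (avg ω) atTop ≤ V} = 1

/-- An environment is upper explorable if it has an upper optimal value `V̄*_ν`. -/
def UpperExplorable (ν : Environment Y O rmax) : Prop := ∃ V, IsUpperOptimalValue ν V

/-- `ν(x_{<k} | y_{<k})` : the probability of the perceptions of the history `h`,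
given its actions. -/
def histProbX (ν : Environment Y O rmax) (h : List (Cycle Y O rmax)) : ℝ :=
  ∏ i : Fin h.length, ν.cond (h.take i.1) (h.get i).1 (h.get i).2

/-- Replace the first `k-1` actions of the policy `p` by the actions `y_{<k}` of the
history `h`. -/
def replacePolicy (h : List (Cycle Y O rmax)) (p : Policy Y O rmax) : Policy Y O rmax :=
  fun l => if hl : l.length < h.length then (h.get ⟨l.length, hl⟩).1 else p l

/-- The measure induced by `(p, ν)` conditional on the history `h = z_{<k}`:
`ν`-probabilities conditional on `x_{<k}`, with the first `k-1` actions of `p`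
replaced by `y_{<k}`. -/
def condMeasure (ν : Environment Y O rmax) (p : Policy Y O rmax)
    (h : List (Cycle Y O rmax)) : Measure (Traj Y O rmax) :=
  ProbabilityTheory.cond (ν.P (replacePolicy h p)) (cylSet h)

/-- `P( · | z_{<k})` under policy `p` in environment `ν`. -/
def condProb (ν : Environment Y O rmax) (p : Policy Y O rmax)
    (h : List (Cycle Y O rmax)) (A : Set (Traj Y O rmax)) : ℝ≥0∞ :=
  condMeasure ν p h A

/-- `V(ν,p,z_{<k}) = V` : conditional on `z_{<k}`, the average limiting value is a.s. `V`. -/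
def CondValueIs (ν : Environment Y O rmax) (p : Policy Y O rmax)
    (h : List (Cycle Y O rmax)) (V : ℝ) : Prop :=
  condProb ν p h {ω | Tendsto (avg ω) atTop (nhds V)} = 1

/-- `V̄(ν,p,z_{<k}) = V` : conditional on `z_{<k}`, the upper limiting average value
is a.s. `V`. -/
def CondUpperValueIs (ν : Environment Y O rmax) (p : Policy Y O rmax)
    (h : List (Cycle Y O rmax)) (V : ℝ) : Prop :=
  condProb ν p h {ω | limsup (avg ω) atTop = V} = 1

/-- `V` is the conditional optimal value `V*_ν(z_{<k})`. -/
def IsCondOptimalValue (ν : Environment Y O rmax) (h : List (Cycle Y O rmax)) (V : ℝ) : Prop :=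
  ∃ p, CondValueIs ν p h V ∧
    ∀ q : Policy Y O rmax, condProb ν q h {ω | limsup (avg ω) atTop ≤ V} = 1

/-- `V` is the conditional upper optimal value `V̄*_ν(z_{<k})`. -/
def IsCondUpperOptimalValue (ν : Environment Y O rmax) (h : List (Cycle Y O rmax)) (V : ℝ) :
    Prop :=
  ∃ p, CondUpperValueIs ν p h V ∧
    ∀ q : Policy Y O rmax, condProb ν q h {ω | limsup (avg ω) atTop ≤ V} = 1

/-- Strongly explorable: after any history of positive probability there is a conditionally
optimal value. -/
def StronglyExplorable (ν : Environment Y O rmax) : Prop :=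
  ∀ h, 0 < histProbX ν h → ∃ V, IsCondOptimalValue ν h V

/-- Strongly upper explorable. -/
def StronglyUpperExplorable (ν : Environment Y O rmax) : Prop :=
  ∀ h, 0 < histProbX ν h → ∃ V, IsCondUpperOptimalValue ν h V

/-- The worst-case optimal value `W*_ν = inf_{z_{<k}} V*_ν(z_{<k})`. -/
def Wstar (ν : Environment Y O rmax) : ℝ :=
  sInf {V | ∃ h, 0 < histProbX ν h ∧ IsCondOptimalValue ν h V}

/-- The worst-case upper optimal value `W̄*_ν = inf_{z_{<k}} V̄*_ν(z_{<k})`. -/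
def WstarUpper (ν : Environment Y O rmax) : ℝ :=
  sInf {V | ∃ h, 0 < histProbX ν h ∧ IsCondUpperOptimalValue ν h V}

/-- Recoverable: after any history of positive probability, some policy attains the
upper optimal value `V̄*_ν` with conditional probability 1. -/
def Recoverable (ν : Environment Y O rmax) : Prop :=
  ∃ V, IsUpperOptimalValue ν V ∧
    ∀ h, 0 < histProbX ν h →
      ∃ p, condProb ν p h {ω | limsup (avg ω) atTop = V} = 1

/-- The quantitative part of value-stability, with target value `W`:
rewards `r_i ∈ [0, r_max]` with `(1/n) r_{1..n} → W`, `d(k,ε) = o(k)`,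
`Σ_n φ(n,ε) < ∞`, and from any history `z_{<k}` some policy `p` recovers:
`P( r_{k..k+n} − r^{pν}_{k..k+n} > d(k,ε) + nε | z_{<k} ) ≤ φ(n,ε)`. -/
def ValueStableCore (ν : Environment Y O rmax) (W : ℝ) (r : ℕ → ℝ)
    (d : ℕ → ℝ → ℝ) (φ : ℕ → ℝ → ℝ) : Prop :=
  (∀ i, r i ∈ Set.Icc (0 : ℝ) (rmax : ℝ)) ∧
  Tendsto (fun n => (∑ i ∈ Finset.range n, r i) / n) atTop (nhds W) ∧
  (∀ ε : ℝ, 0 < ε → (fun k : ℕ => d k ε) =o[atTop] fun k : ℕ => (k : ℝ)) ∧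
  (∀ ε : ℝ, 0 < ε → Summable fun n => φ n ε) ∧
  ∀ h : List (Cycle Y O rmax), ∃ p : Policy Y O rmax, ∀ ε : ℝ, 0 < ε → ∀ n : ℕ,
    condProb ν p h
      {ω | d h.length ε + n * ε <
        (∑ i ∈ Finset.Icc h.length (h.length + n), r i)
          - ∑ i ∈ Finset.Icc h.length (h.length + n), rew (ω i)}
      ≤ ENNReal.ofReal (φ n ε)

/-- Value-stability with explicit witnesses `V = V*_ν`, `r`, `d`, `φ`. -/
def ValueStableWith (ν : Environment Y O rmax) (V : ℝ) (r : ℕ → ℝ)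
    (d : ℕ → ℝ → ℝ) (φ : ℕ → ℝ → ℝ) : Prop :=
  IsOptimalValue ν V ∧ ValueStableCore ν V r d φ

/-- A value-stable environment. -/
def ValueStable (ν : Environment Y O rmax) : Prop :=
  ∃ V r d φ, ValueStableWith ν V r d φ

/-- A worst-case value-stable environment: strongly explorable, and the value-stability
condition holds with target `W*_ν`. -/
def WorstCaseValueStable (ν : Environment Y O rmax) : Prop :=
  StronglyExplorable ν ∧ ∃ r d φ, ValueStableCore ν (Wstar ν) r d φ

/-- A policy is self-optimizing for a class `C` if it attains the optimal value `V*_ν`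
in every `ν ∈ C`. -/
def SelfOptimizing (p : Policy Y O rmax) (C : Set (Environment Y O rmax)) : Prop :=
  ∀ ν ∈ C, ∀ V, IsOptimalValue ν V → ValueIs ν p V

/-- A policy is upper self-optimizing for a class `C` if it attains the upper optimal
value `V̄*_ν` in every `ν ∈ C`. -/
def UpperSelfOptimizing (p : Policy Y O rmax) (C : Set (Environment Y O rmax)) : Prop :=
  ∀ ν ∈ C, ∀ V, IsUpperOptimalValue ν V → UpperValueIs ν p V

/-- A deterministic environment: all conditional probabilities are `0` or `1`. -/
def Deterministic (ν : Environment Y O rmax) : Prop :=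
  ∀ h y x, ν.cond h y x = 0 ∨ ν.cond h y x = 1

/-- In a deterministic environment, the perception following history `h` and action `y`. -/
def pick [Nonempty O] (ν : Environment Y O rmax) (h : List (Cycle Y O rmax)) (y : Y) :
    Percept O rmax :=
  if hx : ∃ x, ν.cond h y x = 1 then hx.choose else Classical.arbitrary _

/-- The (deterministic) history generated by policy `p` in a deterministic environment. -/
def detHist [Nonempty O] (ν : Environment Y O rmax) (p : Policy Y O rmax) :
    ℕ → List (Cycle Y O rmax)
  | 0 => []
  | n + 1 =>
      detHist ν p n ++ [(p (detHist ν p n), pick ν (detHist ν p n) (p (detHist ν p n)))]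

/-- The cycle `z_n` generated by policy `p` in a deterministic environment. -/
def detZ [Nonempty O] (ν : Environment Y O rmax) (p : Policy Y O rmax) (n : ℕ) :
    Cycle Y O rmax :=
  (p (detHist ν p n), pick ν (detHist ν p n) (p (detHist ν p n)))

end RL

namespace RL

/-- A (stationary) Markov decision process: the probability of perceiving `x_k` given the
history `z_{<k} y_k` depends only on `y_k` and the previous perception `x_{k-1}` (the
state); `none` encodes the initial situation. -/
def IsMDP {Y O : Type} [Fintype Y] [Fintype O] {rmax : ℕ}
    (ν : Environment Y O rmax) : Prop :=
  ∃ q : Option (Percept O rmax) → Y → Percept O rmax → ℝ,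
    ∀ h y x, ν.cond h y x = q (h.getLast?.map fun z => z.2) y x

/-- An MDP is ergodic if there is a policy under which every state is visited infinitely
often with probability 1. -/
def MDPErgodic {Y O : Type} [Fintype Y] [Fintype O] {rmax : ℕ}
    (ν : Environment Y O rmax) : Prop :=
  ∃ p : Policy Y O rmax,
    ν.P p {ω | ∀ x : Percept O rmax, {i : ℕ | (ω i).2 = x}.Infinite} = 1

/-- The discounted optimality equation of a finite MDP has a solution. -/
theorem exists_discounted_value {S A : Type} [Fintype S] [Fintype A] [Nonempty A]
    (q : S → A → S → ℝ) (hq0 : ∀ s a x, 0 ≤ q s a x)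
    (hq1 : ∀ s a, ∑ x, q s a x = 1) (r : S → ℝ) {β : ℝ} (hβ0 : 0 ≤ β) (hβ1 : β < 1) :
    ∃ v : S → ℝ, ∀ s, (∀ a, ∑ x, q s a x * (r x + β * v x) ≤ v s) ∧
      ∃ a, ∑ x, q s a x * (r x + β * v x) = v s := by
  let T : (S → ℝ) → S → ℝ := fun v s =>
    (univ : Finset A).sup' univ_nonempty fun a => ∑ x, q s a x * (r x + β * v x)
  have key : ∀ v w : S → ℝ, ∀ s, T v s ≤ T w s + β * dist v w := by
    intro v w s
    refine Finset.sup'_le _ _ fun a _ => ?_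
    have h1 : ∑ x, q s a x * (r x + β * w x) ≤ T w s :=
      Finset.le_sup' (fun a => ∑ x, q s a x * (r x + β * w x)) (mem_univ a)
    have h2 : ∑ x, q s a x * (r x + β * v x)
        ≤ ∑ x, (q s a x * (r x + β * w x) + q s a x * (β * dist v w)) := by
      refine Finset.sum_le_sum fun x _ => ?_
      rw [← mul_add]
      refine mul_le_mul_of_nonneg_left ?_ (hq0 s a x)
      have h3 : v x - w x ≤ dist v w :=
        (le_abs_self _).trans (dist_le_pi_dist v w x)
      nlinarith
    rw [Finset.sum_add_distrib, ← Finset.sum_mul, hq1, one_mul] at h2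
    linarith
  have hT : ContractingWith ⟨β, hβ0⟩ T := by
    refine ⟨by exact_mod_cast hβ1, LipschitzWith.of_dist_le_mul fun v w => ?_⟩
    refine (dist_pi_le_iff (by positivity)).2 fun s => ?_
    rw [Real.dist_eq, abs_le]
    have h1 := key v w s
    have h2 := key w v s
    rw [dist_comm w v] at h2
    constructor
    · show -(β * dist v w) ≤ _
      linarith
    · show _ ≤ β * dist v w
      linarith
  refine ⟨ContractingWith.fixedPoint T hT, fun s => ?_⟩
  have hfix := congrFun hT.fixedPoint_isFixedPt s
  set v := ContractingWith.fixedPoint T hT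
  constructor
  · intro a
    rw [← hfix]
    exact Finset.le_sup' (fun a => ∑ x, q s a x * (r x + β * v x)) (mem_univ a)
  · obtain ⟨a, -, ha⟩ := Finset.exists_mem_eq_sup' univ_nonempty
      fun a : A => ∑ x, q s a x * (r x + β * v x)
    exact ⟨a, ha.symm.trans hfix⟩

/-- In a communicating MDP, a nonnegative function that vanishes somewhere and satisfies
`∑ x, q s a x * G x ≤ G s + R` for all actions is bounded by a constant depending only on the MDP
and `R`. -/
theorem exists_bound_of_communicating {S A : Type} [Fintype S]
    (q : S → A → S → ℝ) (hq0 : ∀ s a x, 0 ≤ q s a x)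
    (hcomm : ∀ s t, Relation.ReflTransGen (fun s t => ∃ a, 0 < q s a t) s t) (R : ℝ) :
    ∃ C : ℝ, ∀ G : S → ℝ, (∀ s, 0 ≤ G s) → (∀ s a, ∑ x, q s a x * G x ≤ G s + R) →
      ∀ s t, G s = 0 → G t ≤ C := by
  have path : ∀ s t, ∃ b : ℝ, ∀ G : S → ℝ, (∀ s, 0 ≤ G s) →
      (∀ s a, ∑ x, q s a x * G x ≤ G s + R) → G s = 0 → G t ≤ b := by
    intro s t
    suffices h : ∃ c > (0 : ℝ), ∃ b : ℝ, ∀ G : S → ℝ, (∀ s, 0 ≤ G s) →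
        (∀ s a, ∑ x, q s a x * G x ≤ G s + R) → c * G t ≤ G s + b by
      obtain ⟨c, hc, b, h⟩ := h
      refine ⟨b / c, fun G h0 h1 hs => ?_⟩
      rw [le_div_iff₀ hc]
      have := h G h0 h1
      rw [hs] at this
      linarith
    induction hcomm s t using Relation.ReflTransGen.head_induction_on with
    | refl => exact ⟨1, one_pos, 0, fun G _ _ => by simp⟩
    | @head s s' hss' _ ih =>
      obtain ⟨a, ha⟩ := hss'
      obtain ⟨c, hc, b, h⟩ := ih
      refine ⟨q s a s' * c, mul_pos ha hc, R + q s a s' * b, fun G h0 h1 => ?_⟩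
      have h2 := h G h0 h1
      have h3 : q s a s' * G s' ≤ ∑ x, q s a x * G x :=
        Finset.single_le_sum (f := fun x => q s a x * G x)
          (fun x _ => mul_nonneg (hq0 s a x) (h0 x)) (mem_univ s')
      have h4 := h1 s a
      nlinarith
  choose b hb using path
  obtain ⟨C, hC⟩ := Finite.bddAbove_range fun st : S × S => b st.1 st.2
  exact ⟨C, fun G h0 h1 s t hs => (hb s t G h0 h1 hs).trans (hC ⟨(s, t), rfl⟩)⟩

/-- The average-reward optimality equation of a communicating finite MDP has a solution. -/
theorem exists_average_optimality {S A : Type} [Fintype S] [Fintype A] [Nonempty S] [Nonempty A]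
    (q : S → A → S → ℝ) (hq0 : ∀ s a x, 0 ≤ q s a x)
    (hq1 : ∀ s a, ∑ x, q s a x = 1)
    (hcomm : ∀ s t, Relation.ReflTransGen (fun s t => ∃ a, 0 < q s a t) s t)
    (r : S → ℝ) {R : ℝ} (hr0 : ∀ s, 0 ≤ r s) (hrR : ∀ s, r s ≤ R) :
    ∃ V ∈ Set.Icc 0 R, ∃ f : S → ℝ, ∀ s, (∀ a, ∑ x, q s a x * (r x + f x) ≤ V + f s) ∧
      ∃ a, ∑ x, q s a x * (r x + f x) = V + f s := by
  obtain ⟨C, hC⟩ := exists_bound_of_communicating q hq0 hcomm R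
  let K : Set (ℝ × ℝ × (S → ℝ)) := Set.Icc 0 1 ×ˢ Set.Icc 0 R ×ˢ Set.Icc 0 (fun _ => C)
  let E : Set (ℝ × ℝ × (S → ℝ)) := {e | ∀ s,
    (∀ a, ∑ x, q s a x * (r x + e.1 * e.2.2 x) ≤ e.2.1 + e.2.2 s) ∧
      ∃ a, ∑ x, q s a x * (r x + e.1 * e.2.2 x) = e.2.1 + e.2.2 s}
  have hE : IsClosed E := by
    simp only [E, Set.ofPred_forall, Set.ofPred_and, Set.ofPred_exists]
    refine isClosed_iInter fun s => (isClosed_iInter fun a => ?_).inter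
      (isClosed_iUnion_of_finite fun a => ?_)
    · exact isClosed_le (by fun_prop) (by fun_prop)
    · exact isClosed_eq (by fun_prop) (by fun_prop)
  have hK : IsCompact (K ∩ E) :=
    (isCompact_Icc.prod (isCompact_Icc.prod isCompact_Icc)).inter_right hE
  have hclosed : IsClosed (Prod.fst '' (K ∩ E)) := (hK.image continuous_fst).isClosed
  have hsub : Set.Ico (0 : ℝ) 1 ⊆ Prod.fst '' (K ∩ E) := by
    rintro β ⟨hβ0, hβ1⟩
    obtain ⟨v, hv⟩ := exists_discounted_value q hq0 hq1 r hβ0 hβ1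
    obtain ⟨i, hi⟩ := Finite.exists_min v
    obtain ⟨j, hj⟩ := Finite.exists_max v
    have hmin : 0 ≤ (1 - β) * v i := by
      obtain ⟨a⟩ := ‹Nonempty A›
      have h1 : ∑ x, q i a x * (β * v i) ≤ ∑ x, q i a x * (r x + β * v x) :=
        Finset.sum_le_sum fun x _ => mul_le_mul_of_nonneg_left
          (by nlinarith [hr0 x, hi x]) (hq0 i a x)
      rw [← Finset.sum_mul, hq1] at h1
      nlinarith [(hv i).1 a]
    have hmax : (1 - β) * v j ≤ R := by
      obtain ⟨a, ha⟩ := (hv j).2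
      have h1 : ∑ x, q j a x * (r x + β * v x) ≤ ∑ x, q j a x * (R + β * v j) :=
        Finset.sum_le_sum fun x _ => mul_le_mul_of_nonneg_left
          (by nlinarith [hrR x, hj x]) (hq0 j a x)
      rw [← Finset.sum_mul, hq1] at h1
      nlinarith
    have hall : ∀ x, (1 - β) * v x ≤ R := fun x =>
      (mul_le_mul_of_nonneg_left (hj x) (by linarith)).trans hmax
    have hspan : ∀ t, v t - v i ≤ C := by
      intro t
      refine hC (fun s => v s - v i) (fun s => sub_nonneg.2 (hi s)) (fun s a => ?_) i t
        (sub_self _)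
      have h1 : ∑ x, q s a x * (v x - v i)
          ≤ ∑ x, (q s a x * (r x + β * v x) + q s a x * (R - v i)) :=
        Finset.sum_le_sum fun x _ => by
          rw [← mul_add]
          exact mul_le_mul_of_nonneg_left (by nlinarith [hr0 x, hall x]) (hq0 s a x)
      rw [Finset.sum_add_distrib, ← Finset.sum_mul, hq1] at h1
      linarith [(hv s).1 a]
    have hshift : ∀ s a, ∑ x, q s a x * (r x + β * (v x - v i))
        = ∑ x, q s a x * (r x + β * v x) - β * v i := by
      intro s a
      have : ∀ x, q s a x * (r x + β * (v x - v i))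
          = q s a x * (r x + β * v x) - q s a x * (β * v i) := fun x => by ring
      simp only [this, Finset.sum_sub_distrib, ← Finset.sum_mul, hq1, one_mul]
    refine ⟨(β, (1 - β) * v i, fun s => v s - v i), ⟨⟨⟨hβ0, hβ1.le⟩, ⟨hmin, hall i⟩,
      fun s => sub_nonneg.2 (hi s), fun s => hspan s⟩, fun s => ⟨fun a => ?_, ?_⟩⟩, rfl⟩
    · simp only [hshift]
      linarith [(hv s).1 a]
    · obtain ⟨a, ha⟩ := (hv s).2
      refine ⟨a, ?_⟩
      simp only [hshift]
      linarith
  have h1 : (1 : ℝ) ∈ Prod.fst '' (K ∩ E) := by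
    refine hclosed.closure_subset_iff.2 hsub ?_
    rw [closure_Ico (by norm_num)]
    simp
  obtain ⟨⟨β, V, f⟩, ⟨⟨-, hV, -⟩, hf⟩, rfl⟩ := h1
  exact ⟨V, hV, f, by simpa [E] using hf⟩

/-- Chernoff-type bound: one exponential moment, uniformly over all centred (or negatively biased)
finite distributions supported in `[-B, B]`. -/
theorem exists_exp_moment_le {S : Type} [Fintype S] (B : ℝ) {ε : ℝ} (hε : 0 < ε) :
    ∃ l > (0 : ℝ), ∃ κ : ℝ, 0 ≤ κ ∧ κ < 1 ∧ ∀ w Δ : S → ℝ, (∀ x, 0 ≤ w x) → ∑ x, w x = 1 →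
      ∑ x, w x * Δ x ≤ 0 → (∀ x, |Δ x| ≤ B) → ∑ x, w x * Real.exp (l * (Δ x - ε)) ≤ κ := by
  set l := min (1 / (|B| + 1)) (ε / (2 * (B ^ 2 + 1))) with hl
  have hl0 : 0 < l := lt_min (by positivity) (by positivity)
  have h1 : l * |B| ≤ 1 := by
    have : l * (|B| + 1) ≤ 1 := (le_div_iff₀ (by positivity)).1 (min_le_left _ _)
    linarith
  have h2 : l * B ^ 2 ≤ ε / 2 := by
    have : l * (2 * (B ^ 2 + 1)) ≤ ε := (le_div_iff₀ (by positivity)).1 (min_le_right _ _)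
    linarith
  refine ⟨l, hl0, Real.exp (-(l * ε / 2)), (Real.exp_pos _).le, ?_, ?_⟩
  · rw [Real.exp_lt_one_iff]
    have := mul_pos hl0 hε
    linarith
  intro w Δ hw0 hw1 hmean hB
  have hpt : ∀ x, w x * Real.exp (l * (Δ x - ε))
      ≤ Real.exp (-(l * ε)) * (w x + l * (w x * Δ x) + w x * (l ^ 2 * B ^ 2)) := by
    intro x
    have hx : |l * Δ x| ≤ 1 := by
      rw [abs_mul, abs_of_pos hl0]
      exact (mul_le_mul_of_nonneg_left ((hB x).trans (le_abs_self B)) hl0.le).trans h1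
    have h3 := (abs_le.1 (Real.abs_exp_sub_one_sub_id_le hx)).2
    have h4 : (Δ x) ^ 2 ≤ B ^ 2 := sq_le_sq' (abs_le.1 (hB x)).1 (abs_le.1 (hB x)).2
    have h5 : Real.exp (l * Δ x) ≤ 1 + l * Δ x + l ^ 2 * B ^ 2 := by
      nlinarith [sq_nonneg l]
    have h6 : Real.exp (l * (Δ x - ε)) = Real.exp (-(l * ε)) * Real.exp (l * Δ x) := by
      rw [← Real.exp_add]
      ring_nf
    rw [h6]
    calc w x * (Real.exp (-(l * ε)) * Real.exp (l * Δ x))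
        = Real.exp (-(l * ε)) * (w x * Real.exp (l * Δ x)) := by ring
      _ ≤ Real.exp (-(l * ε)) * (w x * (1 + l * Δ x + l ^ 2 * B ^ 2)) := by
        have := hw0 x
        gcongr
      _ = _ := by ring
  calc ∑ x, w x * Real.exp (l * (Δ x - ε))
      ≤ ∑ x, Real.exp (-(l * ε)) * (w x + l * (w x * Δ x) + w x * (l ^ 2 * B ^ 2)) :=
        Finset.sum_le_sum fun x _ => hpt x
    _ = Real.exp (-(l * ε)) * (1 + l * ∑ x, w x * Δ x + l ^ 2 * B ^ 2) := by
        rw [← Finset.mul_sum, Finset.sum_add_distrib, Finset.sum_add_distrib, ← Finset.mul_sum,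
          ← Finset.sum_mul, hw1, one_mul]
    _ ≤ Real.exp (-(l * ε)) * Real.exp (l * ε / 2) := by
        refine mul_le_mul_of_nonneg_left ?_ (Real.exp_pos _).le
        have h3 := Real.add_one_le_exp (l * ε / 2)
        nlinarith
    _ = Real.exp (-(l * ε / 2)) := by
        rw [← Real.exp_add]
        ring_nf

/-- The initial segment of length `n` of a sequence. -/
def initSeg {A : Type} (ω : ℕ → A) (n : ℕ) : List A := (List.range n).map ω

/-- The state (last perception) after a history. -/
def lastState {Y O : Type} {rmax : ℕ} (l : List (Cycle Y O rmax)) : Option (Percept O rmax) :=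
  l.getLast?.map fun z => z.2

theorem lastState_append {Y O : Type} {rmax : ℕ} (l : List (Cycle Y O rmax))
    (z : Cycle Y O rmax) : lastState (l ++ [z]) = some z.2 := by
  simp [lastState]

theorem length_initSeg {A : Type} (ω : ℕ → A) (n : ℕ) : (initSeg ω n).length = n := by
  simp [initSeg]

theorem initSeg_succ {A : Type} (ω : ℕ → A) (n : ℕ) :
    initSeg ω (n + 1) = initSeg ω n ++ [ω n] := by
  simp [initSeg, List.range_succ]

theorem mem_cylSet_iff {A : Type} (l : List A) (ω : ℕ → A) :
    ω ∈ cylSet l ↔ initSeg ω l.length = l := by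
  constructor
  · intro h
    refine List.ext_getElem (length_initSeg _ _) fun i h1 h2 => ?_
    simpa [initSeg] using h ⟨i, h2⟩
  · intro h i
    have h1 : i.1 < (initSeg ω l.length).length := by
      rw [length_initSeg]
      exact i.2
    have h2 : (initSeg ω l.length)[i.1] = ω i.1 := by simp [initSeg]
    rw [← h2, List.get_eq_getElem]
    congr 1

theorem mem_cylSet_initSeg {A : Type} (ω : ℕ → A) (n : ℕ) : ω ∈ cylSet (initSeg ω n) := by
  rw [mem_cylSet_iff, length_initSeg]

theorem mem_cylSet_append {A : Type} {l : List A} {ω : ℕ → A} (h : ω ∈ cylSet l) :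
    ω ∈ cylSet (l ++ [ω l.length]) := by
  rw [mem_cylSet_iff] at h ⊢
  rw [List.length_append, List.length_singleton, initSeg_succ, h]

theorem drop_initSeg_sum {A : Type} (ω : ℕ → A) (c : A → ℝ) (k m : ℕ) :
    (((initSeg ω (k + m)).drop k).map c).sum = ∑ i ∈ Finset.Ico k (k + m), c (ω i) := by
  induction m with
  | zero => rw [add_zero, List.drop_of_length_le (length_initSeg ω k).le]; simp
  | succ m ih =>
    rw [← add_assoc, initSeg_succ, List.drop_append_of_le_length (by simp [length_initSeg]),
      List.map_append, List.sum_append, ih, Finset.sum_Ico_succ_top (by omega)]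
    simp

theorem measurableSet_cylSet {Y O : Type} {rmax : ℕ} (l : List (Cycle Y O rmax)) :
    MeasurableSet (cylSet l) := by
  have : cylSet l = ⋂ i : Fin l.length, (fun ω : Traj Y O rmax => ω i.1) ⁻¹' {l.get i} := by
    ext ω
    simp [cylSet]
  rw [this]
  exact MeasurableSet.iInter fun i => measurable_pi_apply i.1 MeasurableSpace.measurableSet_top

section

variable {Y O : Type} [Fintype Y] [Fintype O] {rmax : ℕ}

/-- Markov-type inequality for a nonnegative functional of histories that contracts by `κ` in
conditional mean from time `k` on. -/
theorem measure_cylSet_inter_le (ν : Environment Y O rmax) (p : Policy Y O rmax)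
    (F : List (Cycle Y O rmax) → ℝ≥0∞) (κ : ℝ≥0∞) (k : ℕ)
    (hstep : ∀ l, k ≤ l.length →
      ∑ x, F (l ++ [(p l, x)]) * ENNReal.ofReal (ν.cond l (p l) x) ≤ κ * F l) (m : ℕ) :
    ∀ l, k ≤ l.length →
      ν.P p (cylSet l ∩ {ω | 1 ≤ F (initSeg ω (l.length + m))}) ≤ κ ^ m * F l * ν.P p (cylSet l) := by
  induction m with
  | zero =>
    intro l _
    by_cases hF : 1 ≤ F l
    · calc ν.P p (cylSet l ∩ {ω | 1 ≤ F (initSeg ω (l.length + 0))}) ≤ 1 * ν.P p (cylSet l) := by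
            rw [one_mul]
            exact measure_mono Set.inter_subset_left
        _ ≤ _ := by
            rw [pow_zero, one_mul (F l)]
            exact mul_le_mul' hF le_rfl
    · have : cylSet l ∩ {ω | 1 ≤ F (initSeg ω (l.length + 0))} = ∅ := by
        refine Set.eq_empty_of_forall_notMem fun ω hω => hF ?_
        have h1 : 1 ≤ F (initSeg ω (l.length + 0)) := hω.2
        rwa [add_zero, (mem_cylSet_iff l ω).1 hω.1] at h1
      rw [this, measure_empty]
      exact zero_le
  | succ m ih =>
    intro l hl
    have hcover : cylSet l ∩ {ω | 1 ≤ F (initSeg ω (l.length + (m + 1)))} ⊆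
        ⋃ z : Cycle Y O rmax, cylSet (l ++ [z]) ∩
          {ω | 1 ≤ F (initSeg ω ((l ++ [z]).length + m))} := by
      intro ω hω
      refine Set.mem_iUnion.2 ⟨ω l.length, mem_cylSet_append hω.1, ?_⟩
      have h1 : 1 ≤ F (initSeg ω (l.length + (m + 1))) := hω.2
      have h2 : (l ++ [ω l.length]).length + m = l.length + (m + 1) := by
        simp
        omega
      show 1 ≤ F (initSeg ω ((l ++ [ω l.length]).length + m))
      rwa [h2]
    calc ν.P p (cylSet l ∩ {ω | 1 ≤ F (initSeg ω (l.length + (m + 1)))})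
        ≤ ∑ z : Cycle Y O rmax, ν.P p (cylSet (l ++ [z]) ∩
          {ω | 1 ≤ F (initSeg ω ((l ++ [z]).length + m))}) :=
          (measure_mono hcover).trans (measure_iUnion_fintype_le _ _)
      _ ≤ ∑ z : Cycle Y O rmax, κ ^ m * F (l ++ [z]) * (ν.P p (cylSet l) *
            ENNReal.ofReal (if z.1 = p l then ν.cond l z.1 z.2 else 0)) := by
          refine Finset.sum_le_sum fun z _ => ?_
          rw [← ν.P_cyl]
          exact ih _ (by simp; omega)
      _ = ∑ x, κ ^ m * ν.P p (cylSet l) *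
            (F (l ++ [(p l, x)]) * ENNReal.ofReal (ν.cond l (p l) x)) := by
          rw [Fintype.sum_prod_type, Finset.sum_eq_single (p l)]
          · refine Finset.sum_congr rfl fun x _ => ?_
            rw [if_pos rfl]
            ring
          · intro y _ hy
            simp [hy]
          · simp
      _ ≤ κ ^ m * ν.P p (cylSet l) * (κ * F l) := by
          rw [← Finset.mul_sum]
          gcongr
          exact hstep l hl
      _ = _ := by ring

/-- Exponential concentration for the partial sums of `c` along trajectories, when `c` has
nonpositive drift relative to the potential `f` from time `k` on. -/
theorem exists_concentration (B C : ℝ) {ε : ℝ} (hε : 0 < ε) :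
    ∃ κ : ℝ, 0 ≤ κ ∧ κ < 1 ∧ ∀ (ν : Environment Y O rmax) (p : Policy Y O rmax) (k : ℕ)
      (c : Percept O rmax → ℝ) (f : Option (Percept O rmax) → ℝ),
      (∀ l, k ≤ l.length →
        ∑ x, ν.cond l (p l) x * (c x + f (some x)) ≤ f (lastState l)) →
      (∀ s x, |c x + f (some x) - f s| ≤ B) → (∀ s t, f s - f t ≤ C) →
      ∀ l₀ : List (Cycle Y O rmax), l₀.length = k → ∀ m : ℕ,
        ν.P p (cylSet l₀ ∩ {ω | m * ε + C < ∑ i ∈ Finset.Ico k (k + m), c (ω i).2})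
          ≤ ENNReal.ofReal (κ ^ m) * ν.P p (cylSet l₀) := by
  obtain ⟨t, ht, κ, hκ0, hκ1, hexp⟩ := exists_exp_moment_le (S := Percept O rmax) B hε
  refine ⟨κ, hκ0, hκ1, fun ν p k c f hdrift hB hC l₀ hl₀ m => ?_⟩
  let X : List (Cycle Y O rmax) → ℝ := fun l =>
    ((l.drop k).map fun z => c z.2 - ε).sum + f (lastState l) - f (lastState l₀)
  let F : List (Cycle Y O rmax) → ℝ≥0∞ := fun l => ENNReal.ofReal (Real.exp (t * X l))
  have hstep : ∀ l, k ≤ l.length →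
      ∑ x, F (l ++ [(p l, x)]) * ENNReal.ofReal (ν.cond l (p l) x)
        ≤ ENNReal.ofReal κ * F l := by
    intro l hl
    have hX : ∀ x, X (l ++ [(p l, x)])
        = X l + ((c x + f (some x) - f (lastState l)) - ε) := by
      intro x
      simp only [X, List.drop_append_of_le_length hl, List.map_append, List.sum_append,
        lastState_append, List.map_cons, List.map_nil, List.sum_cons, List.sum_nil]
      ring
    have hterm : ∀ x, F (l ++ [(p l, x)]) * ENNReal.ofReal (ν.cond l (p l) x)
        = ENNReal.ofReal (Real.exp (t * X l) * (ν.cond l (p l) x *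
          Real.exp (t * ((c x + f (some x) - f (lastState l)) - ε)))) := by
      intro x
      simp only [F, hX]
      rw [← ENNReal.ofReal_mul (Real.exp_pos _).le, mul_add, Real.exp_add]
      congr 1
      ring
    simp only [hterm]
    rw [← ENNReal.ofReal_sum_of_nonneg fun x _ => mul_nonneg (Real.exp_pos _).le
      (mul_nonneg (ν.cond_nonneg _ _ _) (Real.exp_pos _).le), ← Finset.mul_sum,
      ← ENNReal.ofReal_mul hκ0, mul_comm κ]
    refine ENNReal.ofReal_le_ofReal (mul_le_mul_of_nonneg_left ?_ (Real.exp_pos _).le)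
    refine hexp _ _ (ν.cond_nonneg l (p l)) (ν.cond_sum_one l (p l)) ?_ fun x => hB _ x
    simp only [mul_sub, Finset.sum_sub_distrib, ← Finset.sum_mul, ν.cond_sum_one, one_mul]
    linarith [hdrift l hl]
  have hF0 : F l₀ = 1 := by
    simp only [F, X, List.drop_of_length_le hl₀.le]
    simp
  have hmain := measure_cylSet_inter_le ν p F (ENNReal.ofReal κ) k hstep m l₀ hl₀.ge
  rw [hF0, mul_one, ← ENNReal.ofReal_pow hκ0] at hmain
  refine (measure_mono (Set.inter_subset_inter_right _ fun ω hω => ?_)).trans hmain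
  have hω' : m * ε + C < ∑ i ∈ Finset.Ico k (k + m), c (ω i).2 := hω
  show 1 ≤ ENNReal.ofReal (Real.exp (t * X (initSeg ω (l₀.length + m))))
  rw [ENNReal.one_le_ofReal, Real.one_le_exp_iff]
  refine mul_nonneg ht.le ?_
  simp only [X, hl₀]
  rw [drop_initSeg_sum ω (fun z => c z.2 - ε), Finset.sum_sub_distrib, Finset.sum_const,
    Nat.card_Ico, nsmul_eq_mul, Nat.add_sub_cancel_left]
  linarith [hC (lastState l₀) (lastState (initSeg ω (k + m)))]

/-- Under nonpositive drift, the partial sums of `c` are almost surely eventually below `m * ε + C`,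
for every `ε > 0`. -/
theorem ae_eventually_sum_le (ν : Environment Y O rmax) (p : Policy Y O rmax)
    (c : Percept O rmax → ℝ) (f : Option (Percept O rmax) → ℝ) (B C : ℝ)
    (hdrift : ∀ l, ∑ x, ν.cond l (p l) x * (c x + f (some x)) ≤ f (lastState l))
    (hB : ∀ s x, |c x + f (some x) - f s| ≤ B) (hC : ∀ s t, f s - f t ≤ C) :
    ∀ᵐ ω ∂ν.P p, ∀ ε > (0 : ℝ), ∀ᶠ m : ℕ in atTop,
      ∑ i ∈ Finset.range m, c (ω i).2 ≤ m * ε := by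
  have := ν.P_prob p
  have hn : ∀ n : ℕ, ∀ᵐ ω ∂ν.P p, ∀ᶠ m : ℕ in atTop,
      ∑ i ∈ Finset.range m, c (ω i).2 ≤ m * (1 / ((n : ℝ) + 1)) + C := by
    intro n
    obtain ⟨κ, hκ0, hκ1, h⟩ := exists_concentration (Y := Y) (O := O) (rmax := rmax) B C
      (Nat.one_div_pos_of_nat (α := ℝ) (n := n))
    have h1 := fun m => h ν p 0 c f (fun l _ => hdrift l) hB hC [] rfl m
    have hcyl : cylSet ([] : List (Cycle Y O rmax)) = Set.univ := by
      ext ω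
      simp [cylSet]
    simp only [hcyl, Set.univ_inter, measure_univ, mul_one, zero_add,
      ← Finset.range_eq_Ico] at h1
    have h2 : ∑' m : ℕ, ν.P p {ω | (m : ℝ) * (1 / ((n : ℝ) + 1)) + C
        < ∑ i ∈ Finset.range m, c (ω i).2} ≠ ∞ := by
      refine ne_top_of_le_ne_top ?_ (ENNReal.tsum_le_tsum h1)
      exact (summable_geometric_of_lt_one hκ0 hκ1).tsum_ofReal_ne_top
    filter_upwards [ae_eventually_notMem h2] with ω hω
    filter_upwards [hω] with m hm
    exact not_lt.1 hm
  filter_upwards [ae_all_iff.2 hn] with ω hω ε hε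
  obtain ⟨n, hn⟩ := exists_nat_one_div_lt (half_pos hε)
  obtain ⟨N, hN⟩ := exists_nat_ge (C / (ε / 2))
  filter_upwards [hω n, eventually_ge_atTop N] with m hm hmN
  have h1 : (N : ℝ) ≤ m := by exact_mod_cast hmN
  have h2 : C ≤ m * (ε / 2) := (div_le_iff₀ (half_pos hε)).1 (hN.trans h1)
  have h3 : (m : ℝ) * (1 / ((n : ℝ) + 1)) ≤ m * (ε / 2) :=
    mul_le_mul_of_nonneg_left hn.le (Nat.cast_nonneg m)
  linarith

end
/-- In an ergodic MDP every state can be reached from every other state. -/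
theorem MDPErgodic.reachable {Y O : Type} [Fintype Y] [Fintype O] {rmax : ℕ}
    {ν : Environment Y O rmax} (herg : MDPErgodic ν)
    {q : Option (Percept O rmax) → Y → Percept O rmax → ℝ}
    (hq : ∀ h y x, ν.cond h y x = q (lastState h) y x) (s t : Percept O rmax) :
    Relation.ReflTransGen (fun s t => ∃ a, 0 < q (some s) a t) s t := by
  obtain ⟨p, hp⟩ := herg
  let N : Set (Traj Y O rmax) := ⋃ lz : {lz : List (Cycle Y O rmax) × Cycle Y O rmax //
    ν.cond lz.1 lz.2.1 lz.2.2 = 0}, cylSet (lz.1.1 ++ [lz.1.2])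
  have hN : ν.P p N = 0 := by
    refine measure_iUnion_null fun lz => ?_
    rw [ν.P_cyl, lz.2]
    simp
  obtain ⟨ω, hω, hωN⟩ : ∃ ω, ω ∈ {ω : Traj Y O rmax | ∀ x : Percept O rmax,
      {i : ℕ | (ω i).2 = x}.Infinite} ∧ ω ∉ N := by
    by_contra! hsub
    have h1 := measure_mono_null (μ := ν.P p) hsub hN
    rw [hp] at h1
    exact one_ne_zero h1
  have hω' : ∀ x : Percept O rmax, {i : ℕ | (ω i).2 = x}.Infinite := hω
  have hedge : ∀ i, ∃ a, 0 < q (some (ω i).2) a (ω (i + 1)).2 := by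
    intro i
    refine ⟨(ω (i + 1)).1, lt_of_le_of_ne ?_ fun h => hωN (Set.mem_iUnion.2
      ⟨⟨(initSeg ω (i + 1), ω (i + 1)), ?_⟩, ?_⟩)⟩
    · have := ν.cond_nonneg (initSeg ω (i + 1)) (ω (i + 1)).1 (ω (i + 1)).2
      rwa [hq, initSeg_succ, lastState_append] at this
    · rw [hq, initSeg_succ, lastState_append]
      exact h.symm
    · rw [← initSeg_succ]
      exact mem_cylSet_initSeg _ _
  obtain ⟨i, hi⟩ := (hω' s).nonempty
  obtain ⟨j, hj, hij⟩ := (hω' t).exists_gt i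
  have hchain : ∀ m, Relation.ReflTransGen (fun s t => ∃ a, 0 < q (some s) a t)
      (ω i).2 (ω (i + m)).2 := by
    intro m
    induction m with
    | zero => exact .refl
    | succ m ih => exact ih.tail (hedge (i + m))
  have hi' : (ω i).2 = s := hi
  have hj' : (ω j).2 = t := hj
  have := hchain (j - i)
  rwa [Nat.add_sub_cancel' hij.le, hi', hj'] at this

/-- In an ergodic MDP the average-reward optimality equation, extended to the initial situation
`none`, has a solution. -/
theorem exists_optimality_equation {Y O : Type} [Fintype Y] [Fintype O]
    [Nonempty Y] [Nonempty O] {rmax : ℕ} {ν : Environment Y O rmax} (herg : MDPErgodic ν)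
    {q : Option (Percept O rmax) → Y → Percept O rmax → ℝ}
    (hq : ∀ h y x, ν.cond h y x = q (lastState h) y x) :
    ∃ V ∈ Set.Icc (0 : ℝ) rmax, ∃ f : Option (Percept O rmax) → ℝ,
      ∀ s, (∀ y, ∑ x, q s y x * (((x.1 : ℕ) : ℝ) + f (some x)) ≤ V + f s) ∧
        ∃ y, ∑ x, q s y x * (((x.1 : ℕ) : ℝ) + f (some x)) = V + f s := by
  have hsome : ∀ (s : Percept O rmax) y x,
      ν.cond [(Classical.arbitrary Y, s)] y x = q (some s) y x := fun s y x => by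
    rw [hq]
    rfl
  obtain ⟨V, hV, g, hg⟩ := exists_average_optimality (fun s => q (some s))
    (fun s y x => by rw [← hsome]; exact ν.cond_nonneg _ _ _)
    (fun s y => by simp only [← hsome]; exact ν.cond_sum_one _ _)
    (herg.reachable hq) (fun x : Percept O rmax => ((x.1 : ℕ) : ℝ)) (R := (rmax : ℝ))
    (fun x => Nat.cast_nonneg _) (fun x => by exact_mod_cast Nat.lt_succ_iff.1 x.1.2)
  obtain ⟨y₀, hy₀⟩ := Finite.exists_max fun y => ∑ x, q none y x * (((x.1 : ℕ) : ℝ) + g x)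
  refine ⟨V, hV, fun s => s.elim
    (∑ x, q none y₀ x * (((x.1 : ℕ) : ℝ) + g x) - V) g, fun s => ?_⟩
  cases s with
  | none => exact ⟨fun y => by simpa using hy₀ y, y₀, by simp⟩
  | some s => exact hg s

/-- **Proposition (MDP ⇒ value-stable).**
Any finite-state ergodic MDP is a value-stable environment. -/
theorem ergodicMDP_valueStable {Y O : Type} [Fintype Y] [Fintype O]
    [Nonempty Y] [Nonempty O] {rmax : ℕ}
    (ν : Environment Y O rmax) (hmdp : IsMDP ν) (herg : MDPErgodic ν) :
    ValueStable ν := by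
  obtain ⟨q, hq⟩ := hmdp
  replace hq : ∀ h y x, ν.cond h y x = q (lastState h) y x := hq
  obtain ⟨V, hV, f, hf⟩ := exists_optimality_equation herg hq
  choose act hact using fun s => (hf s).2
  obtain ⟨B, hB⟩ := Finite.bddAbove_range fun e : Option (Percept O rmax) × Percept O rmax =>
    |((e.2.1 : ℕ) : ℝ) - V + f (some e.2) - f e.1|
  replace hB : ∀ s x, |((x.1 : ℕ) : ℝ) - V + f (some x) - f s| ≤ B :=
    fun s x => hB ⟨(s, x), rfl⟩
  obtain ⟨C, hC⟩ := Finite.bddAbove_range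
    fun e : Option (Percept O rmax) × Option (Percept O rmax) => f e.1 - f e.2
  replace hC : ∀ s t, f s - f t ≤ C := fun s t => hC ⟨(s, t), rfl⟩
  have hB' : ∀ s (x : Percept O rmax),
      |V - ((x.1 : ℕ) : ℝ) + -f (some x) - -f s| ≤ B := fun s x => by
    rw [← abs_neg]
    convert hB s x using 2
    ring
  have hC' : ∀ s t, -f s - -f t ≤ C := fun s t => by linarith [hC t s]
  have hsum : ∀ l y, ∑ x, ν.cond l y x * (((x.1 : ℕ) : ℝ) - V + f (some x))
      = ∑ x, q (lastState l) y x * (((x.1 : ℕ) : ℝ) + f (some x)) - V := by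
    intro l y
    have h1 : ∀ x : Percept O rmax, ν.cond l y x * (((x.1 : ℕ) : ℝ) - V + f (some x))
        = ν.cond l y x * (((x.1 : ℕ) : ℝ) + f (some x)) - ν.cond l y x * V := fun x => by ring
    rw [Finset.sum_congr rfl fun x _ => h1 x, Finset.sum_sub_distrib, ← Finset.sum_mul,
      ν.cond_sum_one, one_mul]
    simp only [hq]
  have hup : ∀ l y, ∑ x, ν.cond l y x * (((x.1 : ℕ) : ℝ) - V + f (some x))
      ≤ f (lastState l) := fun l y => by
    rw [hsum]
    linarith [(hf (lastState l)).1 y]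
  have hlow : ∀ l, ∑ x, ν.cond l (act (lastState l)) x * (V - ((x.1 : ℕ) : ℝ) + -f (some x))
      ≤ -f (lastState l) := by
    intro l
    have h1 : ∀ x : Percept O rmax,
        ν.cond l (act (lastState l)) x * (V - ((x.1 : ℕ) : ℝ) + -f (some x))
        = -(ν.cond l (act (lastState l)) x * (((x.1 : ℕ) : ℝ) - V + f (some x))) :=
      fun x => by ring
    simp only [h1, Finset.sum_neg_distrib, hsum, hact]
    linarith
  have hupper : ∀ p, ∀ᵐ ω ∂ν.P p, ∀ ε > (0 : ℝ), ∀ᶠ m : ℕ in atTop, avg ω m ≤ V + ε := by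
    intro p
    filter_upwards [ae_eventually_sum_le ν p (fun x => ((x.1 : ℕ) : ℝ) - V) f B C
      (fun l => hup l (p l)) hB hC] with ω hω ε hε
    filter_upwards [hω ε hε, eventually_gt_atTop 0] with m hm hm0
    rw [Finset.sum_sub_distrib, Finset.sum_const, Finset.card_range, nsmul_eq_mul] at hm
    have hm0' : (0 : ℝ) < m := by exact_mod_cast hm0
    unfold avg rew
    rw [div_le_iff₀ hm0']
    linarith
  have hlower : ∀ᵐ ω ∂ν.P fun l => act (lastState l), ∀ ε > (0 : ℝ), ∀ᶠ m : ℕ in atTop,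
      V - ε ≤ avg ω m := by
    filter_upwards [ae_eventually_sum_le ν (fun l => act (lastState l))
      (fun x => V - ((x.1 : ℕ) : ℝ)) (fun s => -f s) B C hlow hB' hC'] with ω hω ε hε
    filter_upwards [hω ε hε, eventually_gt_atTop 0] with m hm hm0
    rw [Finset.sum_sub_distrib, Finset.sum_const, Finset.card_range, nsmul_eq_mul] at hm
    have hm0' : (0 : ℝ) < m := by exact_mod_cast hm0
    unfold avg rew
    rw [le_div_iff₀ hm0']
    linarith
  have hone : ∀ p (A : Set (Traj Y O rmax)), (∀ᵐ ω ∂ν.P p, ω ∈ A) → ν.P p A = 1 := by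
    intro p A hA
    have := ν.P_prob p
    exact (measure_congr (show A =ᵐ[ν.P p] Set.univ from eventuallyEq_univ.2 hA)).trans
      measure_univ
  have havg0 : ∀ (ω : Traj Y O rmax) m, 0 ≤ avg ω m := fun ω m =>
    div_nonneg (Finset.sum_nonneg fun i _ => Nat.cast_nonneg _) (Nat.cast_nonneg _)
  choose κ hκ0 hκ1 hconc using fun ε : {ε : ℝ // 0 < ε} =>
    exists_concentration (Y := Y) (O := O) (rmax := rmax) B C ε.2
  refine ⟨V, fun _ => V, fun _ ε => C + ε,
    fun n ε => if hε : 0 < ε then κ ⟨ε, hε⟩ ^ (n + 1) else 0,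
    ⟨fun l => act (lastState l), hone _ _ ?_, fun p => hone _ _ ?_⟩,
    fun _ => hV, ?_, fun ε _ => ?_, fun ε hε => ?_, fun h => ⟨fun l => act (lastState l), ?_⟩⟩
  · filter_upwards [hupper _, hlower] with ω h1 h2
    refine Metric.tendsto_nhds.2 fun ε hε => ?_
    filter_upwards [h1 _ (half_pos hε), h2 _ (half_pos hε)] with m hm1 hm2
    rw [Real.dist_eq, abs_lt]
    constructor <;> linarith
  · filter_upwards [hupper p] with ω h1
    refine le_of_forall_pos_le_add fun ε hε => ?_
    exact limsup_le_of_le (isCoboundedUnder_le_of_le atTop (havg0 ω)) (h1 ε hε)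
  · refine tendsto_const_nhds.congr' ?_
    filter_upwards [eventually_gt_atTop 0] with n hn
    have hn' : (n : ℝ) ≠ 0 := by exact_mod_cast hn.ne'
    rw [Finset.sum_const, Finset.card_range, nsmul_eq_mul]
    field_simp
  · exact isLittleO_const_left.2 (Or.inr (tendsto_norm_atTop_atTop.comp
      tendsto_natCast_atTop_atTop))
  · simp only [hε, dif_pos]
    exact (summable_nat_add_iff 1).2 (summable_geometric_of_lt_one (hκ0 _) (hκ1 _))
  · intro ε hε n
    beta_reduce
    rw [dif_pos hε]
    set p := replacePolicy h fun l => act (lastState l)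
    have := ν.P_prob p
    have hpl : ∀ l, h.length ≤ l.length → p l = act (lastState l) := fun l hl => by
      simp [p, replacePolicy, hl]
    have h1 := hconc ⟨ε, hε⟩ ν p h.length (fun x => V - ((x.1 : ℕ) : ℝ)) (fun s => -f s)
      (fun l hl => by rw [hpl l hl]; exact hlow l) hB' hC' h rfl (n + 1)
    unfold condProb condMeasure
    rw [ProbabilityTheory.cond_apply (measurableSet_cylSet h)]
    have hset : {ω : Traj Y O rmax | C + ε + n * ε <
        (∑ i ∈ Finset.Icc h.length (h.length + n), V)
          - ∑ i ∈ Finset.Icc h.length (h.length + n), rew (ω i)}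
        ⊆ {ω | ((n + 1 : ℕ) : ℝ) * ε + C <
          ∑ i ∈ Finset.Ico h.length (h.length + (n + 1)), (V - (((ω i).2.1 : ℕ) : ℝ))} := by
      intro ω hω
      have hω' : C + ε + n * ε < (∑ i ∈ Finset.Icc h.length (h.length + n), V)
          - ∑ i ∈ Finset.Icc h.length (h.length + n), rew (ω i) := hω
      have hIco : Finset.Ico h.length (h.length + (n + 1))
          = Finset.Icc h.length (h.length + n) := by
        ext i
        simp only [Finset.mem_Ico, Finset.mem_Icc]
        omega
      rw [← Finset.sum_sub_distrib] at hω'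
      show ((n + 1 : ℕ) : ℝ) * ε + C <
        ∑ i ∈ Finset.Ico h.length (h.length + (n + 1)), (V - (((ω i).2.1 : ℕ) : ℝ))
      rw [hIco]
      push_cast
      unfold rew at hω'
      linarith
    calc (ν.P p (cylSet h))⁻¹ * ν.P p (cylSet h ∩ _)
        ≤ (ν.P p (cylSet h))⁻¹ * (ENNReal.ofReal (κ ⟨ε, hε⟩ ^ (n + 1)) * ν.P p (cylSet h)) := by
          gcongr
          exact (measure_mono (Set.inter_subset_inter_right _ hset)).trans h1
      _ = ENNReal.ofReal (κ ⟨ε, hε⟩ ^ (n + 1)) * ((ν.P p (cylSet h))⁻¹ * ν.P p (cylSet h)) := by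
          ring
      _ ≤ ENNReal.ofReal (κ ⟨ε, hε⟩ ^ (n + 1)) * 1 := by
          gcongr
          exact ENNReal.inv_mul_le_one _
      _ = _ := mul_one _

end RL
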